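/- arXiv:1406.5573 — 2 statements merged into one kernel-verified Lean document; each statement's English description precedes it below -/
import Mathlib

section
/- Let n ∈ ℕ and let A, B ⊆ ℝ^{n+2} be disjoint subsets. Then for every s ∈ [0,1], every point p = (t, v) ∈ ΣA, and every b ∈ B, the point ξ_s(p, b) = (t, v − (1−s·|t|)·b) ∈ ℝ × ℝ^{n+2} is nonzero. Hence (s, p, b) ↦ ξ_s(p, b) is a continuous map [0,1] × ΣA × B → ℝ^{n+3} ∖ {0} with ξ_0((t,v), b) = (t, v − b) and ξ_1((t,v), b) = (t, v − (1−|t|)·b). -/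
/-- The suspension `ΣA ⊆ ℝ × ℝ^{n+2}` of a subset `A ⊆ ℝ^{n+2}`:
`ΣA = {(t, (1-|t|)·a) : t ∈ [-1,1], a ∈ A}`. -/
def susp (n : ℕ) (A : Set (EuclideanSpace ℝ (Fin (n + 2)))) :
    Set (ℝ × EuclideanSpace ℝ (Fin (n + 2))) :=
  {p | ∃ t ∈ Set.Icc (-1 : ℝ) 1, ∃ a ∈ A, p = (t, (1 - |t|) • a)}

/-- The homotopy `ξ_s((t,v), b) = (t, v - (1 - s·|t|)·b)`. -/
noncomputable def xiMap (n : ℕ)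
    (x : ℝ × ((ℝ × EuclideanSpace ℝ (Fin (n + 2))) × EuclideanSpace ℝ (Fin (n + 2)))) :
    ℝ × EuclideanSpace ℝ (Fin (n + 2)) :=
  (x.2.1.1, x.2.1.2 - (1 - x.1 * |x.2.1.1|) • x.2.2)

theorem stmt_4 (n : ℕ) (A B : Set (EuclideanSpace ℝ (Fin (n + 2))))
    (hAB : Disjoint A B) :
    (∀ s ∈ Set.Icc (0 : ℝ) 1, ∀ p ∈ susp n A, ∀ b ∈ B, xiMap n (s, p, b) ≠ 0) ∧
    ContinuousOn (xiMap n)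
      (Set.Icc (0 : ℝ) 1 ×ˢ (susp n A ×ˢ B)) ∧
    (∀ (p : ℝ × EuclideanSpace ℝ (Fin (n + 2))) (b : EuclideanSpace ℝ (Fin (n + 2))),
      xiMap n (0, p, b) = (p.1, p.2 - b)) ∧
    (∀ (p : ℝ × EuclideanSpace ℝ (Fin (n + 2))) (b : EuclideanSpace ℝ (Fin (n + 2))),
      xiMap n (1, p, b) = (p.1, p.2 - (1 - |p.1|) • b)) := by
  refine ⟨?_, ?_, ?_, ?_⟩
  · rintro s - p ⟨t, -, a, ha, rfl⟩ b hb h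
    obtain ⟨rfl, hv⟩ : t = 0 ∧ (1 - |t|) • a - (1 - s * |t|) • b = 0 := Prod.mk_eq_zero.1 h
    have hab : a = b := by simpa [sub_eq_zero] using hv
    exact Set.disjoint_left.1 hAB ha (hab ▸ hb)
  · unfold xiMap
    fun_prop
  · intro p b
    simp [xiMap]
  · intro p b
    simp [xiMap]
end

section
/- Let n ∈ ℕ and let A, B ⊆ ℝ^{n+2} be disjoint subsets. Consider the continuous maps β², γ² : Σ²A × Σ²B → ℝ^{n+6} given by β²((s, t, v), (u, u′, w)) = (s, t, u, u′, v − w) and γ²((s, t, v), (u, u′, w)) = (s, t, u, u′, (1−|u|)(1−|u′|)·v − (1−|s|)(1−|t|)·w). Then β² and γ² take values in ℝ^{n+6} ∖ {0} and are homotopic in ℝ^{n+6} ∖ {0}; that is, there exists a continuous map H : [0,1] × (Σ²A × Σ²B) → ℝ^{n+6} ∖ {0} with H(0, ·) = β² and H(1, ·) = γ². -/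
/-- `ℝ^{n+2}` as Euclidean space. -/
abbrev Euc (n : ℕ) := EuclideanSpace ℝ (Fin (n + 2))

/-- The double suspension `Σ²A ⊆ ℝ² × ℝ^{n+2}` of a subset `A ⊆ ℝ^{n+2}`:
`Σ²A = {(s, t, (1-|s|)(1-|t|)·a) : s, t ∈ [-1,1], a ∈ A}`. -/
def susp2 (n : ℕ) (A : Set (Euc n)) : Set (ℝ × ℝ × Euc n) :=
  {p | ∃ s ∈ Set.Icc (-1 : ℝ) 1, ∃ t ∈ Set.Icc (-1 : ℝ) 1, ∃ a ∈ A,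
    p = (s, t, ((1 - |s|) * (1 - |t|)) • a)}

/-- `β²((s,t,v),(u,u',w)) = (s, t, u, u', v - w)`. -/
noncomputable def beta2Map (n : ℕ) (x : (ℝ × ℝ × Euc n) × (ℝ × ℝ × Euc n)) :
    ℝ × ℝ × ℝ × ℝ × Euc n :=
  (x.1.1, x.1.2.1, x.2.1, x.2.2.1, x.1.2.2 - x.2.2.2)

/-- `γ²((s,t,v),(u,u',w)) = (s, t, u, u', (1-|u|)(1-|u'|)·v - (1-|s|)(1-|t|)·w)`. -/
noncomputable def gamma2Map (n : ℕ) (x : (ℝ × ℝ × Euc n) × (ℝ × ℝ × Euc n)) :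
    ℝ × ℝ × ℝ × ℝ × Euc n :=
  (x.1.1, x.1.2.1, x.2.1, x.2.2.1,
    ((1 - |x.2.1|) * (1 - |x.2.2.1|)) • x.1.2.2 -
      ((1 - |x.1.1|) * (1 - |x.1.2.1|)) • x.2.2.2)

/-- A convex combination of `beta2Map` and `gamma2Map` never vanishes on `Σ²A × Σ²B`: where the four
suspension coordinates are zero, both maps equal `a - b`. -/
theorem lineMap_beta2Map_gamma2Map_ne_zero {n : ℕ} {A B : Set (Euc n)} (hAB : Disjoint A B)
    {p q : ℝ × ℝ × Euc n} (hp : p ∈ susp2 n A) (hq : q ∈ susp2 n B) (τ : ℝ) :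
    AffineMap.lineMap (beta2Map n (p, q)) (gamma2Map n (p, q)) τ ≠ 0 := by
  obtain ⟨s, -, t, -, a, ha, rfl⟩ := hp
  obtain ⟨u, -, u', -, b, hb, rfl⟩ := hq
  intro h
  simp only [beta2Map, gamma2Map, AffineMap.lineMap_apply_module', Prod.mk_sub_mk, Prod.smul_mk,
    Prod.mk_add_mk, Prod.mk_eq_zero, sub_self, smul_zero, zero_add] at h
  obtain ⟨rfl, rfl, rfl, rfl, h⟩ := h
  have hab : a - b = 0 := by simpa using h
  exact hAB.ne_of_mem ha hb (sub_eq_zero.mp hab)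

theorem stmt_8 (n : ℕ) (A B : Set (Euc n)) (hAB : Disjoint A B) :
    -- β² takes values in ℝ^{n+6} ∖ {0}
    (∀ p ∈ susp2 n A, ∀ q ∈ susp2 n B, beta2Map n (p, q) ≠ 0) ∧
    -- γ² takes values in ℝ^{n+6} ∖ {0}
    (∀ p ∈ susp2 n A, ∀ q ∈ susp2 n B, gamma2Map n (p, q) ≠ 0) ∧
    -- β² and γ² are homotopic in ℝ^{n+6} ∖ {0}
    ∃ H : Set.Icc (0 : ℝ) 1 ×
        {x : (ℝ × ℝ × Euc n) × (ℝ × ℝ × Euc n) // x.1 ∈ susp2 n A ∧ x.2 ∈ susp2 n B} →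
        {y : ℝ × ℝ × ℝ × ℝ × Euc n // y ≠ 0},
      Continuous H ∧
      (∀ x, (H (⟨0, Set.left_mem_Icc.mpr zero_le_one⟩, x) : ℝ × ℝ × ℝ × ℝ × Euc n) =
        beta2Map n x) ∧
      (∀ x, (H (⟨1, Set.right_mem_Icc.mpr zero_le_one⟩, x) : ℝ × ℝ × ℝ × ℝ × Euc n) =
        gamma2Map n x) := by
  refine ⟨fun p hp q hq => ?_, fun p hp q hq => ?_, fun y =>
    ⟨AffineMap.lineMap (beta2Map n y.2) (gamma2Map n y.2) (y.1 : ℝ),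
      lineMap_beta2Map_gamma2Map_ne_zero hAB y.2.2.1 y.2.2.2 y.1⟩, ?_, fun x => ?_, fun x => ?_⟩
  · simpa using lineMap_beta2Map_gamma2Map_ne_zero hAB hp hq 0
  · simpa using lineMap_beta2Map_gamma2Map_ne_zero hAB hp hq 1
  · refine Continuous.subtype_mk ?_ _
    simp only [AffineMap.lineMap_apply_module, beta2Map, gamma2Map]
    fun_prop
  · simp
  · simp
end
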